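/- Let G be a group acting on a topological space X by homeomorphisms, let Y be a T1 topological space, and let π : X → Y be a pseudo-quotient, i.e. a continuous, surjective, G-invariant map such that for any two disjoint closed G-invariant subsets W₁, W₂ ⊆ X the closures of π(W₁) and π(W₂) in Y are disjoint. Then for every closed G-invariant subset W ⊆ X, the image π(W) is closed in Y. -/

import Mathlib

/-- A pseudo-quotient: a continuous, surjective, `G`-invariant map such that disjoint
closed `G`-invariant subsets of `X` have disjoint image-closures in `Y`. -/
def IsPseudoQuotient (G : Type*) [Group G] {X Y : Type*} [TopologicalSpace X]
    [TopologicalSpace Y] [MulAction G X] (π : X → Y) : Prop :=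
  Continuous π ∧ Function.Surjective π ∧ (∀ (g : G) (x : X), π (g • x) = π x) ∧
    ∀ W₁ W₂ : Set X, IsClosed W₁ → IsClosed W₂ →
      (∀ (g : G), ∀ x ∈ W₁, g • x ∈ W₁) → (∀ (g : G), ∀ x ∈ W₂, g • x ∈ W₂) →
      Disjoint W₁ W₂ → Disjoint (closure (π '' W₁)) (closure (π '' W₂))

theorem stmt_14 {G X Y : Type*} [Group G] [TopologicalSpace X] [TopologicalSpace Y]
    [MulAction G X] [ContinuousConstSMul G X] [T1Space Y] (π : X → Y)
    (hπ : IsPseudoQuotient G π) (W : Set X) (hW : IsClosed W)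
    (hWinv : ∀ (g : G), ∀ x ∈ W, g • x ∈ W) : IsClosed (π '' W) := by
  obtain ⟨hc, hs, hinv, hd⟩ := hπ
  refine isClosed_of_closure_subset fun y hy => ?_
  by_contra hyW
  have hdisj : Disjoint W (π ⁻¹' {y}) := by
    rw [Set.disjoint_left]
    intro x hx hxy
    exact hyW ⟨x, hx, hxy⟩
  have h := hd W (π ⁻¹' {y}) hW (isClosed_singleton.preimage hc) hWinv
    (fun g x hx => (hinv g x).trans hx) hdisj
  obtain ⟨x, hx⟩ := hs y
  exact Set.disjoint_left.mp h hy (subset_closure ⟨x, hx, hx⟩)
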